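/- (Density Lemma.) Let a and c be real constants with a > 1 and c > a, and set t(a,c) = (2a/c)^{a/(a−1)} · e^{−(a+1)/(a−1)}. Then almost surely the Erdős–Rényi random graph G(n, c/n) contains no vertex set S with 2 ≤ |S| ≤ t(a,c)·n spanning at least a·|S| edges. -/

import Mathlib

open MeasureTheory Filter

noncomputable instance {n : ℕ} : MeasurableSpace (SimpleGraph (Fin n)) := ⊤

/-- The Bernoulli(p) measure on `Bool`. -/
noncomputable def bernoulliMeasure (p : ℝ) : Measure Bool :=
  ENNReal.ofReal p • Measure.dirac true + ENNReal.ofReal (1 - p) • Measure.dirac false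

/-- The Erdős–Rényi measure on simple graphs on `Fin n`: the pushforward to
`SimpleGraph (Fin n)` of the product Bernoulli(p) measure over unordered pairs
of distinct vertices. -/
noncomputable def erdosRenyi (n : ℕ) (p : ℝ) : Measure (SimpleGraph (Fin n)) :=
  Measure.map
    (fun f : ({e : Sym2 (Fin n) // ¬ e.IsDiag} → Bool) =>
      SimpleGraph.fromEdgeSet {e : Sym2 (Fin n) | ∃ h : ¬ e.IsDiag, f ⟨e, h⟩ = true})
    (Measure.pi fun _ => bernoulliMeasure p)

/-- The edges of `G` spanned by the vertex set `S`. -/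
def spannedEdges {n : ℕ} (G : SimpleGraph (Fin n)) (S : Finset (Fin n)) : Set (Sym2 (Fin n)) :=
  {e | e ∈ G.edgeSet ∧ ∀ v ∈ e, v ∈ S}

/-- `H` is a (2,3)-tight (Laman) graph on the vertex set `S`: all edges of `H` lie
inside `S`, every subset `T ⊆ S` with `|T| ≥ 2` spans at most `2|T| - 3` edges, and
`H` has exactly `2|S| - 3` edges. -/
def IsTightOn {n : ℕ} (H : SimpleGraph (Fin n)) (S : Finset (Fin n)) : Prop :=
  (∀ e ∈ H.edgeSet, ∀ v ∈ e, v ∈ S) ∧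
  (∀ T : Finset (Fin n), T ⊆ S → 2 ≤ T.card →
    (spannedEdges H T).ncard ≤ 2 * T.card - 3) ∧
  H.edgeSet.ncard = 2 * S.card - 3

/-- The induced subgraph `G[S]` is rigid: it contains a spanning (2,3)-tight subgraph. -/
def IsRigidOn {n : ℕ} (G : SimpleGraph (Fin n)) (S : Finset (Fin n)) : Prop :=
  ∃ H ≤ G, IsTightOn H S

/-- `S` is a rigid component of `G`: `|S| ≥ 2`, `G[S]` is rigid, and `S` is
inclusion-wise maximal with this property. -/
def IsRigidComponent {n : ℕ} (G : SimpleGraph (Fin n)) (S : Finset (Fin n)) : Prop :=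
  2 ≤ S.card ∧ IsRigidOn G S ∧
  ∀ S' : Finset (Fin n), S ⊆ S' → IsRigidOn G S' → S' = S

theorem isProbabilityMeasure_bernoulliMeasure_of {p : ℝ} (h : p ∈ Set.Icc (0 : ℝ) 1) :
    IsProbabilityMeasure (bernoulliMeasure p) := by
  refine ⟨?_⟩
  simp only [bernoulliMeasure, Measure.add_apply, Measure.smul_apply, measure_univ, smul_eq_mul,
    mul_one]
  rw [← ENNReal.ofReal_add h.1 (sub_nonneg.2 h.2)]
  simp

theorem isProbabilityMeasure_erdosRenyi (n : ℕ) {p : ℝ} (h : p ∈ Set.Icc (0 : ℝ) 1) :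
    IsProbabilityMeasure (erdosRenyi n p) := by
  have := isProbabilityMeasure_bernoulliMeasure_of h
  exact Measure.isProbabilityMeasure_map (measurable_of_countable _).aemeasurable

theorem erdosRenyi_superset_le {n : ℕ} {p : ℝ} (h : p ∈ Set.Icc (0 : ℝ) 1)
    (E : Finset (Sym2 (Fin n))) (hE : ∀ e ∈ E, ¬ e.IsDiag) :
    erdosRenyi n p {G | (E : Set (Sym2 (Fin n))) ⊆ G.edgeSet} ≤ ENNReal.ofReal p ^ E.card := by
  classical
  have := isProbabilityMeasure_bernoulliMeasure_of h
  rw [erdosRenyi, Measure.map_apply (measurable_of_countable _) MeasurableSpace.measurableSet_top]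
  let F : Finset {e : Sym2 (Fin n) // ¬ e.IsDiag} := E.subtype _
  have hF : F.card = E.card := by
    rw [Finset.card_subtype, Finset.filter_true_of_mem hE]
  calc _ ≤ Measure.pi (fun _ => bernoulliMeasure p)
        (Set.univ.pi fun e => if e ∈ F then {true} else Set.univ) := by
        apply measure_mono
        intro f hf e _
        by_cases he : e ∈ F
        · have h1 : (e : Sym2 (Fin n)) ∈ E := by simpa [F] using he
          have h2 := hf h1
          simp only [SimpleGraph.edgeSet_fromEdgeSet] at h2
          obtain ⟨_, h3⟩ := h2.1
          simpa [he] using h3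
        · simp [he]
    _ = ENNReal.ofReal p ^ E.card := by
        rw [Measure.pi_pi, ← hF]
        have : ∀ e : {e : Sym2 (Fin n) // ¬ e.IsDiag},
            bernoulliMeasure p (if e ∈ F then {true} else Set.univ) =
              if e ∈ F then ENNReal.ofReal p else 1 := by
          intro e
          split_ifs
          · simp [bernoulliMeasure]
          · exact measure_univ
        simp_rw [this]
        rw [Finset.prod_ite_mem, Finset.univ_inter, Finset.prod_const]

theorem erdosRenyi_spannedEdges_le {n : ℕ} {p : ℝ} (h : p ∈ Set.Icc (0 : ℝ) 1)
    (S : Finset (Fin n)) (m : ℕ) :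
    erdosRenyi n p {G | m ≤ (spannedEdges G S).ncard} ≤
      ((S.card.choose 2).choose m : ℕ) * ENNReal.ofReal p ^ m := by
  classical
  set D : Finset (Sym2 (Fin n)) := S.offDiag.image Sym2.mk.uncurry with hD
  have hDc : D.card = S.card.choose 2 := Sym2.card_image_offDiag S
  have hDd : ∀ e ∈ D, ¬ e.IsDiag := by
    intro e he
    simp only [hD, Finset.mem_image, Finset.mem_offDiag] at he
    obtain ⟨⟨x, y⟩, hx, rfl⟩ := he
    simpa using hx.2.2
  have hsub : ∀ G : SimpleGraph (Fin n), spannedEdges G S ⊆ D := by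
    rintro G e ⟨he, hv⟩
    induction e with
    | _ x y =>
      rw [SimpleGraph.mem_edgeSet] at he
      simp only [hD, Finset.coe_image, Set.mem_image, Finset.mem_coe, Finset.mem_offDiag]
      exact ⟨(x, y), ⟨hv x (by simp), hv y (by simp), he.ne⟩, rfl⟩
  calc _ ≤ erdosRenyi n p (⋃ E ∈ D.powersetCard m,
          {G | (E : Set (Sym2 (Fin n))) ⊆ G.edgeSet}) := by
        apply measure_mono
        intro G hG
        obtain ⟨E, hE, hEm⟩ := Set.exists_subset_card_eq (Set.mem_ofPred.1 hG)
        have hfin : E.Finite := Set.toFinite E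
        simp only [Set.mem_iUnion, Set.mem_ofPred_eq]
        refine ⟨hfin.toFinset, Finset.mem_powersetCard.2 ⟨?_, ?_⟩, ?_⟩
        · intro e he
          exact hsub G (hE (by simpa using he))
        · rw [← hEm, Set.ncard_eq_toFinset_card E hfin]
        · intro e he
          exact (hE (by simpa using he)).1
    _ ≤ ∑ E ∈ D.powersetCard m, erdosRenyi n p {G | (E : Set (Sym2 (Fin n))) ⊆ G.edgeSet} :=
        measure_biUnion_finset_le _ _
    _ ≤ ∑ E ∈ D.powersetCard m, ENNReal.ofReal p ^ m := by
        refine Finset.sum_le_sum fun E hE => ?_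
        rw [Finset.mem_powersetCard] at hE
        rw [← hE.2]
        exact erdosRenyi_superset_le h E fun e he => hDd e (hE.1 he)
    _ = _ := by
        rw [Finset.sum_const, Finset.card_powersetCard, hDc, nsmul_eq_mul]

theorem erdosRenyi_exists_dense_le {n : ℕ} {p : ℝ} (h : p ∈ Set.Icc (0 : ℝ) 1) (a x : ℝ) :
    erdosRenyi n p {G | ∃ S : Finset (Fin n), 2 ≤ S.card ∧ (S.card : ℝ) ≤ x ∧
        a * S.card ≤ ((spannedEdges G S).ncard : ℝ)} ≤
      ENNReal.ofReal (∑ s ∈ Finset.Icc 2 ⌊x⌋₊,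
        (n.choose s : ℝ) * (((s.choose 2).choose ⌈a * s⌉₊ : ℝ) * p ^ ⌈a * s⌉₊)) := by
  classical
  calc _ ≤ erdosRenyi n p (⋃ s ∈ Finset.Icc 2 ⌊x⌋₊,
          ⋃ S ∈ (Finset.univ : Finset (Fin n)).powersetCard s,
          {G | ⌈a * s⌉₊ ≤ (spannedEdges G S).ncard}) := by
        apply measure_mono
        rintro G ⟨S, h2, hx, ha⟩
        simp only [Set.mem_iUnion]
        refine ⟨S.card, Finset.mem_Icc.2 ⟨h2, Nat.le_floor hx⟩, S, by simp, ?_⟩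
        exact Nat.ceil_le.2 ha
    _ ≤ ∑ s ∈ Finset.Icc 2 ⌊x⌋₊, ∑ S ∈ (Finset.univ : Finset (Fin n)).powersetCard s,
          erdosRenyi n p {G | ⌈a * s⌉₊ ≤ (spannedEdges G S).ncard} :=
        (measure_biUnion_finset_le _ _).trans
          (Finset.sum_le_sum fun _ _ => measure_biUnion_finset_le _ _)
    _ ≤ ∑ s ∈ Finset.Icc 2 ⌊x⌋₊, ∑ S ∈ (Finset.univ : Finset (Fin n)).powersetCard s,
          ((s.choose 2).choose ⌈a * s⌉₊ : ℕ) * ENNReal.ofReal p ^ ⌈a * s⌉₊ := by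
        refine Finset.sum_le_sum fun s _ => Finset.sum_le_sum fun S hS => ?_
        have := erdosRenyi_spannedEdges_le h S ⌈a * s⌉₊
        rwa [(Finset.mem_powersetCard.1 hS).2] at this
    _ = _ := by
        have hp := h.1
        rw [ENNReal.ofReal_sum_of_nonneg fun s _ => by positivity]
        refine Finset.sum_congr rfl fun s _ => ?_
        rw [Finset.sum_const, Finset.card_powersetCard, Finset.card_univ, Fintype.card_fin,
          nsmul_eq_mul, ENNReal.ofReal_mul (by positivity), ENNReal.ofReal_mul (by positivity),
          ENNReal.ofReal_natCast, ENNReal.ofReal_natCast, ENNReal.ofReal_pow hp]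

theorem sqrt_mul_div_exp_pow_le_factorial (n : ℕ) :
    √(n : ℝ) * (n / Real.exp 1) ^ n ≤ (n.factorial : ℝ) := by
  refine le_trans ?_ (Stirling.le_factorial_stirling n)
  gcongr
  nlinarith [Real.pi_gt_three, (Nat.cast_nonneg n : (0 : ℝ) ≤ n)]

theorem choose_le_pow_div_sqrt (n : ℕ) {k : ℕ} (hk : 0 < k) :
    (n.choose k : ℝ) ≤ (Real.exp 1 * n / k) ^ k / √(k : ℝ) := by
  have hk' : (0 : ℝ) < k := by exact_mod_cast hk
  calc (n.choose k : ℝ) ≤ (n : ℝ) ^ k / k.factorial := Nat.choose_le_pow_div k n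
    _ ≤ (n : ℝ) ^ k / (√(k : ℝ) * (k / Real.exp 1) ^ k) := by
        gcongr
        exact sqrt_mul_div_exp_pow_le_factorial k
    _ = _ := by
        rw [div_pow, div_pow, mul_pow]
        field_simp

theorem choose_le_exp_mul_div_pow (n : ℕ) {k : ℕ} (hk : 0 < k) :
    (n.choose k : ℝ) ≤ (Real.exp 1 * n / k) ^ k := by
  refine (choose_le_pow_div_sqrt n hk).trans (div_le_self (by positivity) ?_)
  rw [Real.one_le_sqrt]
  exact_mod_cast hk

/-- The expected number of pairs of an `s`-set and `⌈a s⌉` edges inside it, bounded by Stirling. -/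
theorem expected_dense_le {a c t : ℝ} (ha : 1 < a) (hca : a < c)
    (ht : t = (2 * a / c) ^ (a / (a - 1)) * Real.exp (-((a + 1) / (a - 1))))
    {n s : ℕ} (hn : 0 < n) (hs : 0 < s) (hst : (s : ℝ) ≤ t * n) :
    (n.choose s : ℝ) * (((s.choose 2).choose ⌈a * s⌉₊ : ℝ) * (c / n) ^ ⌈a * s⌉₊) ≤
      (s / (t * n)) ^ ((a - 1) * s) / √(s : ℝ) := by
  have ha1 : 0 < a - 1 := sub_pos.2 ha
  have hc : 0 < c := by linarith
  have hn' : (0 : ℝ) < n := by exact_mod_cast hn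
  have hs' : (0 : ℝ) < s := by exact_mod_cast hs
  obtain ⟨L, hL⟩ : ∃ L, 2 * a / c = Real.exp L := ⟨_, (Real.exp_log (by positivity)).symm⟩
  obtain ⟨u, hu⟩ : ∃ u, (s : ℝ) / n = Real.exp u := ⟨_, (Real.exp_log (by positivity)).symm⟩
  obtain ⟨T, hT⟩ : ∃ T, T = (a * L - (a + 1)) / (a - 1) := ⟨_, rfl⟩
  have hT' : (a - 1) * T = a * L - (a + 1) := by rw [hT]; field_simp
  have htT : t = Real.exp T := by
    rw [ht, hL, ← Real.exp_mul, ← Real.exp_add, hT]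
    congr 1
    field_simp
    ring
  have huT : u ≤ T := by
    rw [← Real.exp_le_exp, ← hu, ← htT, div_le_iff₀ hn']
    exact hst
  have hL1 : L ≤ 1 := by
    rw [← Real.exp_le_exp, ← hL, div_le_iff₀ hc]
    nlinarith [Real.add_one_le_exp (1 : ℝ)]
  have hx1 : 1 + u - L ≤ 0 := by nlinarith
  set m := ⌈a * s⌉₊ with hm
  have hms : a * s ≤ m := Nat.le_ceil _
  have hm0' : (0 : ℝ) < m := lt_of_lt_of_le (by positivity) hms
  have hm0 : 0 < m := by exact_mod_cast hm0'
  have hN : ((s.choose 2 : ℕ) : ℝ) ≤ (s : ℝ) ^ 2 / 2 := by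
    simpa using Nat.choose_le_pow_div (α := ℝ) 2 s
  have hedge : ((s.choose 2).choose m : ℝ) * (c / n) ^ m ≤ Real.exp (a * s * (1 + u - L)) := by
    calc _ ≤ (Real.exp 1 * (s.choose 2 : ℕ) / m) ^ m * (c / n) ^ m := by
          gcongr
          exact choose_le_exp_mul_div_pow _ hm0
      _ ≤ (Real.exp 1 * ((s : ℝ) ^ 2 / 2) / (a * s)) ^ m * (c / n) ^ m := by gcongr
      _ = Real.exp (1 + u - L) ^ m := by
          rw [← mul_pow, Real.exp_sub, Real.exp_add, ← hL, ← hu]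
          congr 1
          field_simp
      _ = Real.exp (m * (1 + u - L)) := by rw [← Real.exp_nat_mul]
      _ ≤ _ := by
          rw [Real.exp_le_exp]
          nlinarith
  have hset : (n.choose s : ℝ) ≤ Real.exp (s * (1 - u)) / √(s : ℝ) := by
    refine (choose_le_pow_div_sqrt n hs).trans_eq ?_
    rw [Real.exp_nat_mul, Real.exp_sub, ← hu]
    congr 2
    field_simp
  have hr : (s : ℝ) / (t * n) = Real.exp (u - T) := by
    rw [Real.exp_sub, ← hu, ← htT]
    field_simp
  calc _ ≤ Real.exp (s * (1 - u)) / √(s : ℝ) * Real.exp (a * s * (1 + u - L)) := by gcongr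
    _ = _ := by
        rw [hr, ← Real.exp_mul, div_mul_eq_mul_div, ← Real.exp_add]
        congr 2
        linear_combination (s : ℝ) * hT'

theorem rpow_div_mul_le_exp {b N s : ℝ} (hb : 0 < b) (hN : 0 < N) (hs : 0 ≤ s) :
    (s / N) ^ (b * s) ≤ Real.exp (-(b * (s / N * (N - s)))) := by
  have h : s / N ≤ Real.exp (s / N - 1) := by
    simpa using Real.add_one_le_exp (s / N - 1)
  calc (s / N) ^ (b * s) ≤ Real.exp (s / N - 1) ^ (b * s) := by gcongr
    _ = _ := by
        rw [← Real.exp_mul]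
        congr 1
        field_simp
        ring

theorem tendsto_tsum_rpow_div_mul {b : ℝ} (hb : 0 < b) :
    Tendsto (fun N : ℝ => ∑' s : ℕ,
      if 1 ≤ s ∧ (s : ℝ) ≤ N / 2 then ((s : ℝ) / N) ^ (b * s) else 0) atTop (nhds 0) := by
  have h := tendsto_tsum_of_dominated_convergence (𝓕 := atTop) (g := fun _ : ℕ => (0 : ℝ))
    (f := fun (N : ℝ) (s : ℕ) =>
      if 1 ≤ s ∧ (s : ℝ) ≤ N / 2 then ((s : ℝ) / N) ^ (b * s) else 0)
    (bound := fun s : ℕ => Real.exp (-(b / 2)) ^ s)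
    (summable_geometric_of_lt_one (Real.exp_nonneg _) (by simpa using hb)) ?_ ?_
  · simpa using h
  · intro s
    rcases Nat.eq_zero_or_pos s with rfl | hs
    · simp
    have hlim : Tendsto (fun N : ℝ => ((s : ℝ) / N) ^ (b * s)) atTop (nhds 0) := by
      have hs' : (0 : ℝ) < s := by exact_mod_cast hs
      have := (tendsto_const_nhds (x := (s : ℝ))).div_atTop (tendsto_id (α := ℝ))
      simpa [Real.zero_rpow (mul_pos hb hs').ne'] using
        this.rpow_const (p := b * s) (Or.inr (by positivity))
    refine squeeze_zero' ?_ ?_ hlim <;> filter_upwards [eventually_ge_atTop 0] with N hN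
    · split_ifs <;> positivity
    · split_ifs
      · exact le_rfl
      · positivity
  · filter_upwards [eventually_gt_atTop 0] with N hN s
    split_ifs with h
    · rw [Real.norm_of_nonneg (by positivity), ← Real.exp_nat_mul]
      refine (rpow_div_mul_le_exp hb hN (by positivity)).trans (Real.exp_le_exp.2 ?_)
      have h1 : (s : ℝ) / 2 ≤ s / N * (N - s) := by
        rw [div_mul_eq_mul_div, le_div_iff₀ hN]
        nlinarith [h.2, (Nat.cast_nonneg s : (0 : ℝ) ≤ s)]
      nlinarith
    · rw [norm_zero]
      positivity

theorem sum_rpow_div_mul_div_sqrt_le {b N : ℝ} (hb : 0 < b) (hN : 0 < N) :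
    ∑ s ∈ Finset.Icc 2 ⌊N⌋₊, ((s : ℝ) / N) ^ (b * s) / √(s : ℝ) ≤
      (∑' s : ℕ, if 1 ≤ s ∧ (s : ℝ) ≤ N / 2 then ((s : ℝ) / N) ^ (b * s) else 0) +
        (1 - Real.exp (-(b / 2)))⁻¹ / √(N / 2) := by
  set q := Real.exp (-(b / 2)) with hq
  have hq1 : q < 1 := by simpa [hq] using hb
  have hq0 : 0 < q := Real.exp_pos _
  set f : ℕ → ℝ := fun s => if 1 ≤ s ∧ (s : ℝ) ≤ N / 2 then ((s : ℝ) / N) ^ (b * s) else 0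
    with hf
  have hf0 : ∀ s, 0 ≤ f s := fun s => by simp only [hf]; split_ifs <;> positivity
  have hfs : Summable f := by
    refine summable_of_ne_finset_zero (s := Finset.range (⌊N / 2⌋₊ + 1)) fun s hs => if_neg ?_
    rintro ⟨-, h⟩
    exact hs (Finset.mem_range_succ_iff.2 (Nat.le_floor h))
  have hterm : ∀ s ∈ Finset.Icc 2 ⌊N⌋₊, ((s : ℝ) / N) ^ (b * s) / √(s : ℝ) ≤
      f s + q ^ (⌊N⌋₊ - s) / √(N / 2) := by
    intro s hs
    rw [Finset.mem_Icc] at hs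
    have hs1 : (1 : ℝ) ≤ s := by exact_mod_cast (by omega : 1 ≤ s)
    by_cases h : (s : ℝ) ≤ N / 2
    · have hfe : f s = ((s : ℝ) / N) ^ (b * s) := if_pos ⟨by omega, h⟩
      have h1 : ((s : ℝ) / N) ^ (b * s) / √(s : ℝ) ≤ ((s : ℝ) / N) ^ (b * s) :=
        div_le_self (by positivity) (Real.one_le_sqrt.2 hs1)
      have h2 : 0 ≤ q ^ (⌊N⌋₊ - s) / √(N / 2) := by positivity
      linarith
    · push Not at h
      have h1 : ((s : ℝ) / N) ^ (b * s) ≤ q ^ (⌊N⌋₊ - s) := by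
        rw [hq, ← Real.exp_nat_mul, Nat.cast_sub hs.2]
        refine (rpow_div_mul_le_exp hb hN (by positivity)).trans (Real.exp_le_exp.2 ?_)
        have hfl : (⌊N⌋₊ : ℝ) ≤ N := Nat.floor_le hN.le
        have hsf : (s : ℝ) ≤ ⌊N⌋₊ := by exact_mod_cast hs.2
        have h3 : 1 / 2 ≤ (s : ℝ) / N := by
          rw [le_div_iff₀ hN]
          linarith
        have h4 : 1 / 2 * ((⌊N⌋₊ : ℝ) - s) ≤ s / N * (N - s) := by
          gcongr
        nlinarith
      have h2 : ((s : ℝ) / N) ^ (b * s) / √(s : ℝ) ≤ q ^ (⌊N⌋₊ - s) / √(N / 2) := by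
        gcongr
      linarith [hf0 s]
  have hgeom : ∑ s ∈ Finset.Icc 2 ⌊N⌋₊, q ^ (⌊N⌋₊ - s) ≤ (1 - q)⁻¹ := by
    calc _ ≤ ∑ s ∈ Finset.range (⌊N⌋₊ + 1), q ^ (⌊N⌋₊ - s) := by
          refine Finset.sum_le_sum_of_subset_of_nonneg (fun s hs => ?_) fun _ _ _ => by positivity
          rw [Finset.mem_Icc] at hs
          exact Finset.mem_range_succ_iff.2 hs.2
      _ = ∑ s ∈ Finset.range (⌊N⌋₊ + 1), q ^ s := by
          rw [← Finset.sum_range_reflect]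
          refine Finset.sum_congr rfl fun s hs => ?_
          rw [Finset.mem_range] at hs
          congr 1
          omega
      _ ≤ _ := by
          rw [← tsum_geometric_of_lt_one hq0.le hq1]
          exact (summable_geometric_of_lt_one hq0.le hq1).sum_le_tsum _ fun _ _ => by positivity
  calc _ ≤ ∑ s ∈ Finset.Icc 2 ⌊N⌋₊, (f s + q ^ (⌊N⌋₊ - s) / √(N / 2)) :=
        Finset.sum_le_sum hterm
    _ = ∑ s ∈ Finset.Icc 2 ⌊N⌋₊, f s +
          (∑ s ∈ Finset.Icc 2 ⌊N⌋₊, q ^ (⌊N⌋₊ - s)) / √(N / 2) := by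
        rw [Finset.sum_add_distrib, Finset.sum_div]
    _ ≤ _ := by
        gcongr
        exact hfs.sum_le_tsum _ fun s _ => hf0 s

theorem tendsto_sum_rpow_div_mul_div_sqrt {b : ℝ} (hb : 0 < b) :
    Tendsto (fun N : ℝ => ∑ s ∈ Finset.Icc 2 ⌊N⌋₊, ((s : ℝ) / N) ^ (b * s) / √(s : ℝ))
      atTop (nhds 0) := by
  have hsqrt : Tendsto (fun N : ℝ => (1 - Real.exp (-(b / 2)))⁻¹ / √(N / 2)) atTop (nhds 0) :=
    tendsto_const_nhds.div_atTop
      (Real.tendsto_sqrt_atTop.comp (tendsto_id.atTop_div_const two_pos))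
  have h := (tendsto_tsum_rpow_div_mul hb).add hsqrt
  rw [add_zero] at h
  refine squeeze_zero' ?_ ?_ h <;> filter_upwards [eventually_gt_atTop 0] with N hN
  · positivity
  · exact sum_rpow_div_mul_div_sqrt_le hb hN

/-- Density Lemma: for constants `a > 1` and `c > a`, with
`t(a,c) = (2a/c)^(a/(a-1)) · e^(-(a+1)/(a-1))`, almost surely `G(n, c/n)` contains
no vertex set `S` with `2 ≤ |S| ≤ t(a,c)·n` spanning at least `a·|S|` edges. -/
theorem density_lemma (a c : ℝ) (ha : 1 < a) (hca : a < c)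
    (t : ℝ) (ht : t = (2 * a / c) ^ (a / (a - 1)) * Real.exp (-((a + 1) / (a - 1)))) :
    Tendsto (fun n : ℕ =>
      erdosRenyi n (c / n)
        {G | ¬ ∃ S : Finset (Fin n), 2 ≤ S.card ∧ (S.card : ℝ) ≤ t * n ∧
          a * S.card ≤ ((spannedEdges G S).ncard : ℝ)})
      atTop (nhds 1) := by
  have hc : 0 < c := by linarith
  have hb : 0 < a - 1 := sub_pos.2 ha
  have ht0 : 0 < t := by rw [ht]; positivity
  have hp : ∀ᶠ n : ℕ in atTop, 0 < n ∧ c / n ∈ Set.Icc (0 : ℝ) 1 := by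
    filter_upwards [eventually_gt_atTop 0, eventually_ge_atTop ⌈c⌉₊] with n hn hcn
    have hn' : (0 : ℝ) < n := by exact_mod_cast hn
    exact ⟨hn, by positivity, (div_le_one hn').2 (Nat.ceil_le.1 hcn)⟩
  have hsum : Tendsto (fun n : ℕ => ENNReal.ofReal
      (∑ s ∈ Finset.Icc 2 ⌊t * n⌋₊, ((s : ℝ) / (t * n)) ^ ((a - 1) * s) / √(s : ℝ)))
      atTop (nhds 0) := by
    rw [← ENNReal.ofReal_zero]
    exact ENNReal.tendsto_ofReal ((tendsto_sum_rpow_div_mul_div_sqrt hb).comp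
      (tendsto_natCast_atTop_atTop.const_mul_atTop ht0))
  have hbad : Tendsto (fun n : ℕ => erdosRenyi n (c / n)
      {G | ∃ S : Finset (Fin n), 2 ≤ S.card ∧ (S.card : ℝ) ≤ t * n ∧
        a * S.card ≤ ((spannedEdges G S).ncard : ℝ)}) atTop (nhds 0) := by
    refine tendsto_of_tendsto_of_tendsto_of_le_of_le' tendsto_const_nhds hsum
      (Eventually.of_forall fun _ => zero_le) ?_
    filter_upwards [hp] with n hn
    refine (erdosRenyi_exists_dense_le hn.2 a (t * n)).trans (ENNReal.ofReal_le_ofReal ?_)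
    refine Finset.sum_le_sum fun s hs => ?_
    rw [Finset.mem_Icc] at hs
    exact expected_dense_le ha hca ht hn.1 (by omega)
      ((Nat.le_floor_iff (by positivity)).1 hs.2)
  have hsub := ENNReal.Tendsto.sub (tendsto_const_nhds (x := (1 : ENNReal)) (f := atTop)) hbad
    (Or.inl ENNReal.one_ne_top)
  rw [tsub_zero] at hsub
  refine hsub.congr' ?_
  filter_upwards [hp] with n hn
  have := isProbabilityMeasure_erdosRenyi n hn.2
  rw [← Set.compl_ofPred, prob_compl_eq_one_sub MeasurableSpace.measurableSet_top]
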